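/- Let σ, σ_p > 0, δ, δ̂ ≥ 0 with 2n(δ̂² − δ²)σ_p² < σ², let X ∈ ℝ^{n×d} have rows x_iᵀ, Y ∈ ℝ^n entries y_i, and let π = N(0, σ_p² I_d). For any radius r ≥ 0 define L_r(θ) = Σ_{i=1}^n (1/(2σ²))(|y_i − x_iᵀθ| + r‖θ‖₂)², let z_δ = ∫ exp(−L_δ(θ)) dπ(θ), and let q_δ be the probability measure with density exp(−L_δ)/z_δ with respect to π. Then E_{θ∼q_δ}[(1/n) L_δ̂(θ)] + (1/n) KL(q_δ‖π) ≤ (2/n) log(1/z_δ) + ( (δ̂² − δ²) σ_p² d / σ² ) / ( 1 − 2n(δ̂² − δ²)σ_p²/σ² ). -/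

import Mathlib

open MeasureTheory ProbabilityTheory Matrix

/-- The Kullback–Leibler divergence `∫ log (dq/dπ) dq` of `q` from `π`
(meaningful when `q ≪ π` and the integrand is integrable). -/
noncomputable def KLreal {Θ : Type*} [MeasurableSpace Θ] (ρ π : Measure Θ) : ℝ :=
  ∫ θ, Real.log ((ρ.rnDeriv π θ).toReal) ∂ρ

/-- Tilting the centered Gaussian density by `exp (s x²)` gives an unnormalized Gaussian. -/
lemma gaussianPDFReal_mul_exp_mul_sq (v : NNReal) (s x : ℝ) :
    gaussianPDFReal 0 v x * Real.exp (s * x ^ 2)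
      = (√(2 * Real.pi * v))⁻¹ * Real.exp (-(1 / (2 * (v : ℝ)) - s) * x ^ 2) := by
  rw [gaussianPDFReal, mul_assoc, ← Real.exp_add]
  congr 2
  ring

/-- The Gaussian exponential quadratic moment is finite below the critical exponent. -/
lemma integrable_exp_mul_sq_gaussianReal {v : NNReal} (hv : v ≠ 0) {s : ℝ}
    (hs : 2 * s * v < 1) :
    Integrable (fun x : ℝ => Real.exp (s * x ^ 2)) (gaussianReal 0 v) := by
  have hv0 : (0 : ℝ) < v := by positivity
  have hb : 0 < 1 / (2 * (v : ℝ)) - s := by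
    rw [sub_pos, lt_div_iff₀ (by positivity)]
    linarith
  rw [gaussianReal_of_var_ne_zero _ hv, integrable_withDensity_iff_integrable_smul'
    (measurable_gaussianPDF _ _) (ae_of_all _ fun _ => gaussianPDF_lt_top)]
  refine ((integrable_exp_neg_mul_sq hb).const_mul (√(2 * Real.pi * v))⁻¹).congr
    (ae_of_all _ fun x => ?_)
  simp only [toReal_gaussianPDF, smul_eq_mul, gaussianPDFReal_mul_exp_mul_sq]

/-- The value of the Gaussian exponential quadratic moment. -/
lemma integral_exp_mul_sq_gaussianReal {v : NNReal} (hv : v ≠ 0) {s : ℝ}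
    (hs : 2 * s * v < 1) :
    ∫ x, Real.exp (s * x ^ 2) ∂gaussianReal 0 v = (√(1 - 2 * s * v))⁻¹ := by
  have hv0 : (0 : ℝ) < v := by positivity
  have hs' : 0 < 1 - 2 * s * v := by linarith
  rw [integral_gaussianReal_eq_integral_smul hv]
  simp_rw [smul_eq_mul, gaussianPDFReal_mul_exp_mul_sq]
  rw [integral_const_mul, integral_gaussian, ← Real.sqrt_inv, ← Real.sqrt_inv,
    ← Real.sqrt_mul (by positivity)]
  congr 1
  have : 1 / (2 * (v : ℝ)) - s = (1 - 2 * s * v) / (2 * v) := by field_simp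
  rw [this]
  field_simp

/-- The exponential of a multiple of the squared norm is integrable under an isotropic Gaussian
below the critical exponent. -/
lemma integrable_exp_mul_sum_sq_pi_gaussianReal {ι : Type*} [Fintype ι] {v : NNReal} (hv : v ≠ 0)
    {s : ℝ} (hs : 2 * s * v < 1) :
    Integrable (fun θ : ι → ℝ => Real.exp (s * ∑ j, θ j ^ 2))
      (Measure.pi fun _ => gaussianReal 0 v) := by
  simp_rw [Finset.mul_sum, Real.exp_sum]
  exact Integrable.fintype_prod (f := fun _ x => Real.exp (s * x ^ 2))
    fun _ => integrable_exp_mul_sq_gaussianReal hv hs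

/-- The log-moment bound for the squared norm of an isotropic Gaussian vector. -/
lemma log_integral_exp_mul_sum_sq_pi_gaussianReal_le {ι : Type*} [Fintype ι] {v : NNReal}
    (hv : v ≠ 0) {s : ℝ} (hs : 2 * s * v < 1) :
    Real.log (∫ θ : ι → ℝ, Real.exp (s * ∑ j, θ j ^ 2) ∂Measure.pi fun _ => gaussianReal 0 v)
      ≤ s * v * Fintype.card ι / (1 - 2 * s * v) := by
  have hs' : 0 < 1 - 2 * s * v := by linarith
  simp_rw [Finset.mul_sum, Real.exp_sum]
  rw [integral_fintype_prod_eq_prod (f := fun _ x => Real.exp (s * x ^ 2)),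
    Finset.prod_congr rfl fun _ _ => integral_exp_mul_sq_gaussianReal hv hs,
    Finset.prod_const, Real.log_pow, Real.log_inv, Real.log_sqrt hs'.le, Finset.card_univ]
  have hlog := Real.one_sub_inv_le_log_of_pos hs'
  have hle : -(Real.log (1 - 2 * s * v) / 2) ≤ s * v / (1 - 2 * s * v) := by
    have : s * v / (1 - 2 * s * v) = ((1 - 2 * s * v)⁻¹ - 1) / 2 := by
      rw [eq_div_iff two_ne_zero, eq_sub_iff_add_eq, div_mul_eq_mul_div, inv_eq_one_div,
        div_add_one hs'.ne']
      ring
    linarith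
  calc _ ≤ (Fintype.card ι : ℝ) * (s * v / (1 - 2 * s * v)) := by gcongr
    _ = _ := by ring

/-- A coordinate of an isotropic Gaussian vector is square integrable. -/
lemma memLp_two_eval_pi_gaussianReal {ι : Type*} [Fintype ι] (v : NNReal) (j : ι) :
    MemLp (fun θ : ι → ℝ => θ j) 2 (Measure.pi fun _ => gaussianReal 0 v) :=
  (memLp_id_gaussianReal 2).comp_measurePreserving
    (measurePreserving_eval (fun _ : ι => gaussianReal 0 v) j)

/-- The squared norm of an isotropic Gaussian vector is integrable. -/
lemma integrable_sum_sq_pi_gaussianReal {ι : Type*} [Fintype ι] (v : NNReal) :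
    Integrable (fun θ : ι → ℝ => ∑ j, θ j ^ 2) (Measure.pi fun _ => gaussianReal 0 v) :=
  integrable_finsetSum _ fun j _ => (memLp_two_eval_pi_gaussianReal v j).integrable_sq

/-- The adversarial squared loss of a linear model is integrable under an isotropic Gaussian. -/
lemma integrable_adversarial_loss_pi_gaussianReal {m ι : Type*} [Fintype m] [Fintype ι]
    (v : NNReal) (X : Matrix m ι ℝ) (Y : m → ℝ) (c r : ℝ) :
    Integrable (fun θ : ι → ℝ =>
      ∑ i, c * (|Y i - X.mulVec θ i| + r * √(∑ j, θ j ^ 2)) ^ 2)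
      (Measure.pi fun _ => gaussianReal 0 v) := by
  refine integrable_finsetSum _ fun i _ => Integrable.const_mul (MemLp.integrable_sq ?_) _
  refine MemLp.add (MemLp.abs (MemLp.sub (memLp_const _) ?_)) (MemLp.const_mul ?_ r)
  · simp only [Matrix.mulVec, dotProduct]
    exact memLp_finsetSum _ fun j _ => (memLp_two_eval_pi_gaussianReal v j).const_mul _
  · rw [memLp_two_iff_integrable_sq
      (by fun_prop : Measurable _).aestronglyMeasurable]
    simpa only [Real.sq_sqrt (Finset.sum_nonneg fun _ _ => sq_nonneg _)]
      using integrable_sum_sq_pi_gaussianReal v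

/-- If `L' ≤ 2 L + S`, the Gibbs objective of `L'` at the Gibbs posterior of `L` is controlled by
the normalizer of `L` and the exponential moment of `S` under the prior. -/
lemma integral_add_KLreal_gibbs_le {Θ : Type*} [MeasurableSpace Θ] (μ : Measure Θ)
    [IsProbabilityMeasure μ] {L L' S : Θ → ℝ} (hLm : Measurable L) (hL0 : ∀ θ, 0 ≤ L θ)
    (hL : Integrable L μ) (hL' : Integrable L' μ)
    (hexpS : Integrable (fun θ => Real.exp (S θ)) μ) (hle : ∀ θ, L' θ ≤ 2 * L θ + S θ)
    {z : ℝ} (hz : z = ∫ θ, Real.exp (-L θ) ∂μ) {q : Measure Θ}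
    (hq : q = μ.withDensity fun θ => ENNReal.ofReal (Real.exp (-L θ) / z)) :
    ∫ θ, L' θ ∂q + KLreal q μ ≤ 2 * Real.log (1 / z) + Real.log (∫ θ, Real.exp (S θ) ∂μ) := by
  have hE_le : ∀ θ, Real.exp (-L θ) ≤ 1 := fun θ => by
    simpa using hL0 θ
  have hE : Integrable (fun θ => Real.exp (-L θ)) μ :=
    (integrable_const (1 : ℝ)).mono' (by fun_prop)
      (ae_of_all _ fun θ => by simpa [abs_of_pos (Real.exp_pos _)] using hL0 θ)
  have hz0 : 0 < z := hz ▸ integral_exp_pos hE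
  set M := ∫ θ, Real.exp (S θ) ∂μ with hM
  have hM0 : 0 < M := integral_exp_pos hexpS
  have hwm : Measurable fun θ => Real.exp (-L θ) / z := by fun_prop
  have hw0 : ∀ θ, 0 < Real.exp (-L θ) / z := fun θ => by positivity
  have hw : Integrable (fun θ => Real.exp (-L θ) / z) μ := hE.div_const z
  have hw1 : ∫ θ, Real.exp (-L θ) / z ∂μ = 1 := by
    rw [integral_div, ← hz, div_self hz0.ne']
  have hmul : ∀ {f : Θ → ℝ}, Integrable f μ →
      Integrable (fun θ => Real.exp (-L θ) / z * f θ) μ := fun hf =>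
    hf.bdd_mul (c := 1 / z) hwm.aestronglyMeasurable (ae_of_all _ fun θ => by
      rw [Real.norm_of_nonneg (hw0 θ).le]
      gcongr
      exact hE_le θ)
  have hint : ∀ f : Θ → ℝ, ∫ θ, f θ ∂q = ∫ θ, Real.exp (-L θ) / z * f θ ∂μ := fun f => by
    rw [hq, integral_withDensity_eq_integral_toReal_smul (by fun_prop)
      (ae_of_all _ fun _ => ENNReal.ofReal_lt_top)]
    exact integral_congr_ae (ae_of_all _ fun θ => by simp [ENNReal.toReal_ofReal (hw0 θ).le])
  have hKL : KLreal q μ = ∫ θ, Real.exp (-L θ) / z * (-L θ - Real.log z) ∂μ := by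
    have hac : q ≪ μ := hq ▸ withDensity_absolutelyContinuous _ _
    have hrn : q.rnDeriv μ =ᵐ[μ] fun θ => ENNReal.ofReal (Real.exp (-L θ) / z) := by
      rw [hq]
      exact Measure.rnDeriv_withDensity μ (by fun_prop)
    rw [KLreal, ← hint]
    refine integral_congr_ae ?_
    filter_upwards [hac.ae_le hrn] with θ hθ
    rw [hθ, ENNReal.toReal_ofReal (hw0 θ).le, Real.log_div (Real.exp_ne_zero _) hz0.ne',
      Real.log_exp]
  have hLz : Integrable (fun θ => -L θ - Real.log z) μ := hL.neg.sub (integrable_const _)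
  have hpt : ∀ θ, Real.exp (-L θ) / z * L' θ + Real.exp (-L θ) / z * (-L θ - Real.log z)
      ≤ Real.exp (S θ) / M
        + Real.exp (-L θ) / z * (2 * Real.log (1 / z) + Real.log M - 1) := fun θ => by
    have hexp := mul_le_mul_of_nonneg_left
      (Real.add_one_le_exp (L θ + S θ + Real.log z - Real.log M)) (hw0 θ).le
    have heq : Real.exp (-L θ) / z * Real.exp (L θ + S θ + Real.log z - Real.log M)
        = Real.exp (S θ) / M := by
      rw [Real.exp_sub, Real.exp_add, Real.exp_add, Real.exp_log hz0, Real.exp_log hM0,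
        Real.exp_neg]
      field_simp
    have hmono := mul_le_mul_of_nonneg_left (hle θ) (hw0 θ).le
    rw [heq] at hexp
    rw [one_div, Real.log_inv]
    linarith
  rw [hint, hKL, ← integral_add (hmul hL') (hmul hLz)]
  refine (integral_mono ((hmul hL').add (hmul hLz))
    ((hexpS.div_const M).add (hw.mul_const _)) hpt).trans_eq ?_
  rw [integral_add' (hexpS.div_const M) (hw.mul_const _), integral_div, integral_mul_const, hw1,
    ← hM, div_self hM0.ne']
  ring

/-- Bound on the Gibbs objective of the robust posterior (trained with radius `δ`)
evaluated with the adversarial loss of radius `δ̂`: with prior `π = N(0, σ_p² I_d)`,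
adversarial losses `L_r(θ) = Σᵢ (1/(2σ²))(|yᵢ − xᵢᵀθ| + r‖θ‖₂)²`, normalizer
`z_δ = ∫ exp(−L_δ) dπ` and posterior `q_δ` of density `exp(−L_δ)/z_δ` w.r.t. `π`,
`E_{θ∼q_δ}[(1/n)L_δ̂(θ)] + (1/n)KL(q_δ‖π) ≤ (2/n)log(1/z_δ)
  + ((δ̂² − δ²)σ_p²d/σ²)/(1 − 2n(δ̂² − δ²)σ_p²/σ²)`. -/
theorem robust_posterior_adversarial_gibbs_objective_bound
    (n d : ℕ) (hn : 0 < n) (σ σp δ δh : ℝ)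
    (hσ : 0 < σ) (hσp : 0 < σp) (hδ : 0 ≤ δ) (hδh : 0 ≤ δh)
    (hcond : 2 * (n : ℝ) * (δh ^ 2 - δ ^ 2) * σp ^ 2 < σ ^ 2)
    (X : Matrix (Fin n) (Fin d) ℝ) (Y : Fin n → ℝ)
    (pr : Measure (Fin d → ℝ))
    (hpr : pr = Measure.pi fun _ : Fin d => gaussianReal 0 ⟨σp ^ 2, sq_nonneg σp⟩)
    (Lrad : ℝ → (Fin d → ℝ) → ℝ)
    (hLrad : Lrad = fun r θ => ∑ i, (1 / (2 * σ ^ 2))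
      * (|Y i - X.mulVec θ i| + r * Real.sqrt (∑ j, θ j ^ 2)) ^ 2)
    (zδ : ℝ) (hzδ : zδ = ∫ θ, Real.exp (-Lrad δ θ) ∂pr)
    (qδ : Measure (Fin d → ℝ))
    (hqδ : qδ = pr.withDensity fun θ => ENNReal.ofReal (Real.exp (-Lrad δ θ) / zδ)) :
    (∫ θ, (1 / (n : ℝ)) * Lrad δh θ ∂qδ) + (1 / (n : ℝ)) * KLreal qδ pr
      ≤ (2 / (n : ℝ)) * Real.log (1 / zδ)
        + ((δh ^ 2 - δ ^ 2) * σp ^ 2 * (d : ℝ) / σ ^ 2)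
          / (1 - 2 * (n : ℝ) * (δh ^ 2 - δ ^ 2) * σp ^ 2 / σ ^ 2) := by
  have hn0 : (0 : ℝ) < n := by exact_mod_cast hn
  obtain ⟨v, hv⟩ : ∃ v : NNReal, v = ⟨σp ^ 2, sq_nonneg σp⟩ := ⟨_, rfl⟩
  have hvr : (v : ℝ) = σp ^ 2 := by rw [hv]; rfl
  have hv0 : v ≠ 0 := by
    rw [← NNReal.coe_ne_zero, hvr]
    positivity
  rw [← hv] at hpr
  have : IsProbabilityMeasure pr := by rw [hpr]; infer_instance
  set s : ℝ := n * (δh ^ 2 - δ ^ 2) / σ ^ 2 with hs_def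
  have hu : 2 * s * v = 2 * (n : ℝ) * (δh ^ 2 - δ ^ 2) * σp ^ 2 / σ ^ 2 := by
    rw [hvr, hs_def]
    ring
  have hs : 2 * s * v < 1 := by
    rw [hu, div_lt_one (by positivity)]
    exact hcond
  have hint : ∀ r, Integrable (Lrad r) pr := fun r => by
    rw [hLrad, hpr]
    exact integrable_adversarial_loss_pi_gaussianReal v X Y _ r
  have hmeas : Measurable (Lrad δ) := by
    rw [hLrad]
    simp only [Matrix.mulVec, dotProduct]
    fun_prop
  have hle : ∀ θ, Lrad δh θ ≤ 2 * Lrad δ θ + s * ∑ j, θ j ^ 2 := fun θ => by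
    have hsum : s * ∑ j, θ j ^ 2
        = ∑ _i : Fin n, (1 / (2 * σ ^ 2)) * (2 * (δh ^ 2 - δ ^ 2) * √(∑ j, θ j ^ 2) ^ 2) := by
      rw [Finset.sum_const, Finset.card_univ, Fintype.card_fin, nsmul_eq_mul,
        Real.sq_sqrt (Finset.sum_nonneg fun _ _ => sq_nonneg _), hs_def]
      field_simp
    rw [hsum, hLrad, Finset.mul_sum, ← Finset.sum_add_distrib]
    refine Finset.sum_le_sum fun i _ => ?_
    rw [mul_left_comm, ← mul_add]
    gcongr
    have hcross : 0 ≤ |Y i - X.mulVec θ i| * (δ * √(∑ j, θ j ^ 2)) := by positivity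
    linarith [sq_nonneg (|Y i - X.mulVec θ i| - δh * √(∑ j, θ j ^ 2))]
  have hexp : Integrable (fun θ => Real.exp (s * ∑ j, θ j ^ 2)) pr := by
    rw [hpr]
    exact integrable_exp_mul_sum_sq_pi_gaussianReal hv0 hs
  have hlog : Real.log (∫ θ, Real.exp (s * ∑ j, θ j ^ 2) ∂pr) ≤ s * v * d / (1 - 2 * s * v) := by
    rw [hpr]
    simpa using log_integral_exp_mul_sum_sq_pi_gaussianReal_le (ι := Fin d) hv0 hs
  have hmain := (integral_add_KLreal_gibbs_le pr hmeas (fun θ => by rw [hLrad]; positivity)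
    (hint δ) (hint δh) hexp hle hzδ hqδ).trans (add_le_add_right hlog _)
  rw [integral_const_mul, ← mul_add]
  refine (mul_le_mul_of_nonneg_left hmain (by positivity)).trans_eq ?_
  rw [← hu, hvr, hs_def]
  field_simp
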